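/- Let R ⊆ E be an extension of Rota-Baxter family Hom-associative algebras of weight λ, ρ : E → R a linear retraction, V := ker ρ, and Ω(R,V) := Υ₁(E). Let C(R,E) be the set of Rota-Baxter family Hom complements of R in E and D(R,V) the set of deformation maps of Ω(R,V). Then the map Δ₁ : C(R,E) → D(R,V), sending a complement B to d := −d̃|_V where d̃ is the retraction associated to B, is a bijection; its inverse sends a deformation map d to B := {x + d(x) : x ∈ V}, which is a Rota-Baxter family Hom complement of R in E. -/

import Mathlib

/-- The data of a Rota-Baxter family Hom-associative algebra: a bilinear
multiplication, a family of linear operators indexed by a semigroup `S`,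
and a linear twisting map. -/
structure RBFData (k S R : Type*) [Field k] [Semigroup S]
    [AddCommGroup R] [Module k R] where
  mul : R →ₗ[k] R →ₗ[k] R
  P : S → R →ₗ[k] R
  theta : R →ₗ[k] R

/-- The axioms of a Rota-Baxter family Hom-associative algebra of weight `lam`,
stated for arbitrary operations. -/
def IsRBFOps {k S M : Type*} [Field k] [Semigroup S] [AddCommGroup M] [Module k M]
    (lam : k) (mul : M → M → M) (P : S → M → M) (theta : M → M) : Prop :=
  (∀ x y z : M, mul (theta x) (mul y z) = mul (mul x y) (theta z)) ∧
  (∀ (α β : S) (x y : M), mul (P α x) (P β y)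
      = P (α * β) (mul (P α x) y + mul x (P β y) + lam • mul x y)) ∧
  (∀ (ω : S) (x : M), P ω (theta x) = theta (P ω x))

/-- `(R, ·, (P_ω), θ)` is a Rota-Baxter family Hom-associative algebra of weight `lam`. -/
def RBFData.IsRBF {k S R : Type*} [Field k] [Semigroup S] [AddCommGroup R] [Module k R]
    (A : RBFData k S R) (lam : k) : Prop :=
  IsRBFOps lam (fun x y => A.mul x y) (fun ω x => A.P ω x) (fun x => A.theta x)

/-- An extending datum `Ω(R,V)` of `R` through `V`:
`dR` is `▷ : R×V→V`, `dL` is `◁ : V×R→V`, `hR` is `⇀ : V×R→R`, `hL` is `↼ : R×V→R`,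
`f : V×V→R` is the cocycle, `mulV : V×V→V`, and the linear maps
`Q_ω : V→R`, `PV_ω : V→V`, `eta : V→R`, `thetaV : V→V`. -/
structure ExtDatum (k S R V : Type*) [Field k] [Semigroup S]
    [AddCommGroup R] [Module k R] [AddCommGroup V] [Module k V] where
  dR : R →ₗ[k] V →ₗ[k] V
  dL : V →ₗ[k] R →ₗ[k] V
  hR : V →ₗ[k] R →ₗ[k] R
  hL : R →ₗ[k] V →ₗ[k] R
  f : V →ₗ[k] V →ₗ[k] R
  mulV : V →ₗ[k] V →ₗ[k] V
  Q : S → V →ₗ[k] R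
  PV : S → V →ₗ[k] V
  eta : V →ₗ[k] R
  thetaV : V →ₗ[k] V

/-- The multiplication of the (prospective) unified product `R ♮ V`. -/
def natMul {k S R V : Type*} [Field k] [Semigroup S]
    [AddCommGroup R] [Module k R] [AddCommGroup V] [Module k V]
    (A : RBFData k S R) (D : ExtDatum k S R V) : R × V → R × V → R × V := fun p q =>
  (A.mul p.1 q.1 + D.hL p.1 q.2 + D.hR p.2 q.1 + D.f p.2 q.2,
   D.dR p.1 q.2 + D.dL p.2 q.1 + D.mulV p.2 q.2)

/-- The Rota-Baxter family of the (prospective) unified product `R ♮ V`. -/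
def natP {k S R V : Type*} [Field k] [Semigroup S]
    [AddCommGroup R] [Module k R] [AddCommGroup V] [Module k V]
    (A : RBFData k S R) (D : ExtDatum k S R V) : S → R × V → R × V := fun ω p =>
  (A.P ω p.1 + D.Q ω p.2, D.PV ω p.2)

/-- The twisting map of the (prospective) unified product `R ♮ V`. -/
def natTheta {k S R V : Type*} [Field k] [Semigroup S]
    [AddCommGroup R] [Module k R] [AddCommGroup V] [Module k V]
    (A : RBFData k S R) (D : ExtDatum k S R V) : R × V → R × V := fun p =>
  (A.theta p.1 + D.eta p.2, D.thetaV p.2)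

/-- An extending datum is a Rota-Baxter family Hom extending structure when the
unified product `R ♮ V` is a Rota-Baxter family Hom-associative algebra of weight `lam`. -/
def IsExtendingStructure {k S R V : Type*} [Field k] [Semigroup S]
    [AddCommGroup R] [Module k R] [AddCommGroup V] [Module k V]
    (lam : k) (A : RBFData k S R) (D : ExtDatum k S R V) : Prop :=
  IsRBFOps lam (natMul A D) (natP A D) (natTheta A D)

/-- The projection `E → V = ker ρ`, `u ↦ u - ρ(u)`, associated to a linear
retraction `ρ` of `E` onto the subspace `Rs`. -/
def projV {k E : Type*} [Field k] [AddCommGroup E] [Module k E]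
    (Rs : Submodule k E) (ρ : E →ₗ[k] E)
    (hmem : ∀ u : E, ρ u ∈ Rs) (hid : ∀ a ∈ Rs, ρ a = a) (u : E) :
    ↥(LinearMap.ker ρ) :=
  ⟨u - ρ u, by
    have h := hid (ρ u) (hmem u)
    simp [LinearMap.mem_ker, map_sub, h]⟩

/-- `d : V → R` is a deformation map of the Rota-Baxter family Hom extending
structure `Ω(R,V) = Υ₁(E)` associated to the extension `R ⊆ E` and the retraction
`ρ` (with `V = ker ρ`): writing the maps of `Υ₁(E)` via `ρ` (Eq. (3.3)), the three
deformation-map identities hold. -/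
def IsDefMap {k S E : Type*} [Field k] [Semigroup S] [AddCommGroup E] [Module k E]
    (AE : RBFData k S E) (Rs : Submodule k E) (ρ : E →ₗ[k] E)
    (hmem : ∀ u : E, ρ u ∈ Rs) (hid : ∀ a ∈ Rs, ρ a = a)
    (d : ↥(LinearMap.ker ρ) →ₗ[k] ↥Rs) : Prop :=
  (∀ x y : ↥(LinearMap.ker ρ),
     AE.mul ↑(d x) ↑(d y) - (↑(d (projV Rs ρ hmem hid (AE.mul ↑x ↑y))) : E)
       = (↑(d (projV Rs ρ hmem hid (AE.mul ↑(d x) ↑y)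
             + projV Rs ρ hmem hid (AE.mul ↑x ↑(d y)))) : E)
         - ρ (AE.mul ↑(d x) ↑y) - ρ (AE.mul ↑x ↑(d y)) - ρ (AE.mul ↑x ↑y)) ∧
  (∀ (ω : S) (x : ↥(LinearMap.ker ρ)),
     (↑(d (projV Rs ρ hmem hid (AE.P ω ↑x))) : E)
       = ρ (AE.P ω ↑x) + AE.P ω ↑(d x)) ∧
  (∀ x : ↥(LinearMap.ker ρ),
     (↑(d (projV Rs ρ hmem hid (AE.theta ↑x))) : E)
       = ρ (AE.theta ↑x) + AE.theta ↑(d x))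

section Projection

variable {k E : Type*} [Field k] [AddCommGroup E] [Module k E]
  {Rs : Submodule k E} {ρ : E →ₗ[k] E}
  (hmem : ∀ u : E, ρ u ∈ Rs) (hid : ∀ a ∈ Rs, ρ a = a)

@[simp]
theorem coe_projV (u : E) : (projV Rs ρ hmem hid u : E) = u - ρ u := rfl

theorem projV_add (u v : E) :
    projV Rs ρ hmem hid (u + v) = projV Rs ρ hmem hid u + projV Rs ρ hmem hid v := by
  ext
  simp only [coe_projV, Submodule.coe_add, map_add]
  abel

theorem projV_smul (c : k) (u : E) :
    projV Rs ρ hmem hid (c • u) = c • projV Rs ρ hmem hid u := by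
  ext
  simp [smul_sub]

theorem projV_of_mem {a : E} (ha : a ∈ Rs) : projV Rs ρ hmem hid a = 0 := by
  ext
  simp [hid a ha]

theorem projV_coe (x : LinearMap.ker ρ) : projV Rs ρ hmem hid x = x := by
  ext
  simp

/-- The graph `{x + d(x) : x ∈ ker ρ}` of `d : ker ρ → Rs`, cut out of `E` by the equation
`ρ(u) = d(u - ρ(u))`. -/
def projGraph (d : LinearMap.ker ρ →ₗ[k] Rs) : Submodule k E where
  carrier := {u | ρ u = d (projV Rs ρ hmem hid u)}
  add_mem' {u v} hu hv := by
    simp only [Set.mem_ofPred_eq] at hu hv ⊢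
    simp [projV_add, hu, hv]
  zero_mem' := by simp [projV_of_mem hmem hid Rs.zero_mem]
  smul_mem' c u hu := by
    simp only [Set.mem_ofPred_eq] at hu ⊢
    simp [projV_smul, hu]

variable (d : LinearMap.ker ρ →ₗ[k] Rs)

theorem mem_projGraph {u : E} :
    u ∈ projGraph hmem hid d ↔ ρ u = d (projV Rs ρ hmem hid u) := Iff.rfl

theorem add_mem_projGraph (x : LinearMap.ker ρ) :
    (x : E) + d x ∈ projGraph hmem hid d := by
  have hx : ρ x = 0 := x.2
  rw [mem_projGraph, projV_add, projV_coe, projV_of_mem hmem hid (d x).2, map_add, hx,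
    hid _ (d x).2, zero_add, add_zero]

theorem mem_projGraph_iff_exists {u : E} :
    u ∈ projGraph hmem hid d ↔ ∃ x : LinearMap.ker ρ, u = x + d x := by
  refine ⟨fun hu => ⟨projV Rs ρ hmem hid u, ?_⟩, ?_⟩
  · rw [← (mem_projGraph hmem hid d).1 hu, coe_projV, sub_add_cancel]
  · rintro ⟨x, rfl⟩
    exact add_mem_projGraph hmem hid d x

theorem forall_mem_projGraph {p : E → Prop} :
    (∀ u ∈ projGraph hmem hid d, p u) ↔ ∀ x : LinearMap.ker ρ, p (x + d x) := by
  simp only [mem_projGraph_iff_exists, forall_exists_index]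
  exact ⟨fun h x => h _ x rfl, fun h u x hu => hu ▸ h x⟩

theorem isCompl_projGraph : IsCompl Rs (projGraph hmem hid d) := by
  rw [isCompl_iff, disjoint_iff, codisjoint_iff]
  constructor
  · refine (Submodule.eq_bot_iff _).2 fun u hu => ?_
    have h := (mem_projGraph hmem hid d).1 hu.2
    rwa [hid u hu.1, projV_of_mem hmem hid hu.1, map_zero] at h
  · refine (Submodule.eq_top_iff').2 fun u => ?_
    set x := projV Rs ρ hmem hid u with hx
    refine Submodule.mem_sup.2 ⟨ρ u - d x, Rs.sub_mem (hmem u) (d x).2, x + d x,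
      add_mem_projGraph hmem hid d x, ?_⟩
    rw [hx, coe_projV]
    abel

/-- The restriction `-d̃|_V` to `V = ker ρ` of the negated projection `d̃` onto `Rs` along `B`. -/
noncomputable def negProjRestrict (ρ : E →ₗ[k] E) {B : Submodule k E} (h : IsCompl Rs B) :
    LinearMap.ker ρ →ₗ[k] Rs :=
  -(Rs.projectionOnto B h ∘ₗ (LinearMap.ker ρ).subtype)

theorem negProjRestrict_apply {B : Submodule k E} (h : IsCompl Rs B) (x : LinearMap.ker ρ) :
    negProjRestrict ρ h x = -Rs.projectionOnto B h x := rfl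

theorem projGraph_negProjRestrict {B : Submodule k E} (h : IsCompl Rs B) :
    projGraph hmem hid (negProjRestrict ρ h) = B := by
  ext u
  rw [mem_projGraph, negProjRestrict_apply, coe_projV, map_sub,
    Submodule.projectionOnto_apply_of_mem_left h (hmem u), neg_sub]
  change ((⟨ρ u, hmem u⟩ : Rs) : E) = _ ↔ _
  rw [Subtype.coe_inj, eq_comm, sub_eq_self, Submodule.projectionOnto_apply_eq_zero_iff]

theorem negProjRestrict_projGraph :
    negProjRestrict ρ (isCompl_projGraph hmem hid d) = d := by
  refine LinearMap.ext fun x => ?_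
  have h := (Submodule.projectionOnto_apply_eq_zero_iff (isCompl_projGraph hmem hid d)).2
    (add_mem_projGraph hmem hid d x)
  rw [map_add, Submodule.projectionOnto_apply_left] at h
  rw [negProjRestrict_apply, neg_eq_iff_add_eq_zero, h]

variable {S : Type*} [Semigroup S] (AE : RBFData k S E)

/-- `d` is a deformation map exactly when its graph is stable under all the operations. -/
theorem isDefMap_iff_projGraph_stable
    (hRmul : ∀ a ∈ Rs, ∀ b ∈ Rs, AE.mul a b ∈ Rs)
    (hRP : ∀ (ω : S), ∀ a ∈ Rs, AE.P ω a ∈ Rs)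
    (hRtheta : ∀ a ∈ Rs, AE.theta a ∈ Rs) :
    IsDefMap AE Rs ρ hmem hid d ↔
      (∀ a ∈ projGraph hmem hid d, ∀ b ∈ projGraph hmem hid d,
        AE.mul a b ∈ projGraph hmem hid d) ∧
      (∀ (ω : S), ∀ a ∈ projGraph hmem hid d, AE.P ω a ∈ projGraph hmem hid d) ∧
      (∀ a ∈ projGraph hmem hid d, AE.theta a ∈ projGraph hmem hid d) := by
  simp only [forall_mem_projGraph]
  refine and_congr (forall₂_congr fun x y => ?_)
    (and_congr (forall₂_congr fun ω x => ?_) (forall_congr' fun x => ?_))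
  · have h := hRmul _ (d x).2 _ (d y).2
    simp only [mem_projGraph, map_add, LinearMap.add_apply, projV_add,
      projV_of_mem hmem hid h, hid _ h, add_zero, Submodule.coe_add]
    constructor <;> intro e <;> linear_combination (norm := module) e
  · have h := hRP ω _ (d x).2
    rw [mem_projGraph, map_add, map_add, projV_add, projV_of_mem hmem hid h, hid _ h,
      add_zero, eq_comm]
  · have h := hRtheta _ (d x).2
    rw [mem_projGraph, map_add, map_add, projV_add, projV_of_mem hmem hid h, hid _ h,
      add_zero, eq_comm]

end Projection

/-- Proposition 4.5: let `R ⊆ E` be an extension of Rota-Baxter family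
Hom-associative algebras, `ρ` a linear retraction, `V := ker ρ`, and
`Ω(R,V) := Υ₁(E)`. The map `Δ₁`, sending a Rota-Baxter family Hom complement `B`
of `R` in `E` to `d := -d̃|_V` (where `d̃` is the retraction associated to `B`),
is a bijection from the set `C(R,E)` of complements onto the set `D(R,V)` of
deformation maps of `Ω(R,V)`; its inverse sends `d` to
`B := {x + d(x) : x ∈ V}`. -/
theorem stmt15 {k S E : Type*} [Field k] [Semigroup S] [AddCommGroup E] [Module k E]
    (lam : k) (AE : RBFData k S E) (hAE : AE.IsRBF lam)
    (Rs : Submodule k E)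
    (hRmul : ∀ a ∈ Rs, ∀ b ∈ Rs, AE.mul a b ∈ Rs)
    (hRP : ∀ (ω : S), ∀ a ∈ Rs, AE.P ω a ∈ Rs)
    (hRtheta : ∀ a ∈ Rs, AE.theta a ∈ Rs)
    (ρ : E →ₗ[k] E) (hmem : ∀ u : E, ρ u ∈ Rs) (hid : ∀ a ∈ Rs, ρ a = a) :
    ∃ (F : {B : Submodule k E //
              (∀ a ∈ B, ∀ b ∈ B, AE.mul a b ∈ B) ∧
              (∀ (ω : S), ∀ a ∈ B, AE.P ω a ∈ B) ∧
              (∀ a ∈ B, AE.theta a ∈ B) ∧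
              Rs ⊔ B = ⊤ ∧ Rs ⊓ B = ⊥}
            → {d : ↥(LinearMap.ker ρ) →ₗ[k] ↥Rs // IsDefMap AE Rs ρ hmem hid d})
      (G : {d : ↥(LinearMap.ker ρ) →ₗ[k] ↥Rs // IsDefMap AE Rs ρ hmem hid d}
            → {B : Submodule k E //
                (∀ a ∈ B, ∀ b ∈ B, AE.mul a b ∈ B) ∧
                (∀ (ω : S), ∀ a ∈ B, AE.P ω a ∈ B) ∧
                (∀ a ∈ B, AE.theta a ∈ B) ∧
                Rs ⊔ B = ⊤ ∧ Rs ⊓ B = ⊥}),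
      -- F is Δ₁ : it sends B to -d̃|_V, where d̃ is the retraction associated to B:
      (∀ Bc, ∀ dt : E →ₗ[k] E, (∀ a ∈ Rs, ∀ b ∈ Bc.1, dt (a + b) = a) →
          ∀ x : ↥(LinearMap.ker ρ), (↑((F Bc).1 x) : E) = -(dt ↑x)) ∧
      -- the inverse G sends d to B = {x + d(x) : x ∈ V}:
      (∀ dc (u : E), u ∈ (G dc).1 ↔
          ∃ x : ↥(LinearMap.ker ρ), u = ↑x + ↑(dc.1 x)) ∧
      -- F is a bijection with inverse G:
      Function.LeftInverse G F ∧ Function.RightInverse G F ∧ Function.Bijective F := by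
  have hiff := fun d => isDefMap_iff_projGraph_stable hmem hid d AE hRmul hRP hRtheta
  have hcompl : ∀ {B : Submodule k E}, Rs ⊔ B = ⊤ ∧ Rs ⊓ B = ⊥ → IsCompl Rs B :=
    fun h => ⟨disjoint_iff.2 h.2, codisjoint_iff.2 h.1⟩
  refine ⟨fun B => ⟨negProjRestrict ρ (hcompl B.2.2.2.2), ?_⟩,
    fun d => ⟨projGraph hmem hid d.1, ?_⟩, ?_, fun d u => mem_projGraph_iff_exists hmem hid d.1,
    ?_⟩
  · rw [hiff, projGraph_negProjRestrict]
    exact ⟨B.2.1, B.2.2.1, B.2.2.2.1⟩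
  · have hc := isCompl_projGraph hmem hid d.1
    obtain ⟨h₁, h₂, h₃⟩ := (hiff d.1).1 d.2
    exact ⟨h₁, h₂, h₃, hc.sup_eq_top, hc.inf_eq_bot⟩
  · intro B dt hdt x
    have hc := hcompl B.2.2.2.2
    have h := hdt _ (Rs.projection_apply_mem hc x) _ (Submodule.sub_projection_mem hc x)
    rw [add_sub_cancel] at h
    rw [h]
    rfl
  · rw [← and_assoc]
    refine (fun h => ⟨h, h.1.injective, h.2.surjective⟩) ⟨fun B => ?_, fun d => ?_⟩
    · exact Subtype.ext (projGraph_negProjRestrict hmem hid (hcompl B.2.2.2.2))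
    · exact Subtype.ext (negProjRestrict_projGraph hmem hid d.1)
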